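/- For every n ≥ 2, the size of the smallest deterministic U₂-circuit computing the parity function of n inputs is exactly 3(n−1), i.e., size^dc(Parity_n) = 3(n−1). -/

import Mathlib

/-!
Common definitions: Boolean circuits (with AND/OR/NOT gates of fan-in ≤ 2 and
dummy COPY gates used only for layering), nondeterministic circuits with guess
inputs, width via layerings, nondeterministic branching programs, and
U₂-circuits with their deterministic/nondeterministic circuit complexities.
-/

/-- A node of a circuit with `n` actual inputs and `m` guess inputs.
Gate nodes refer to their predecessors by (strictly smaller) indices. -/
inductive CNode (n m : ℕ) : Type where
  | actual : Fin n → CNode n m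
  | guess  : Fin m → CNode n m
  | const  : Bool → CNode n m
  | gand   : ℕ → ℕ → CNode n m
  | gor    : ℕ → ℕ → CNode n m
  | gnot   : ℕ → CNode n m
  | gcopy  : ℕ → CNode n m
deriving DecidableEq

namespace CNode

/-- The predecessor indices of a node. -/
def preds {n m : ℕ} : CNode n m → List ℕ
  | gand j k => [j, k]
  | gor j k  => [j, k]
  | gnot j   => [j]
  | gcopy j  => [j]
  | _        => []

/-- Real gates (AND, OR, NOT); these are the gates counted in the size.
COPY gates are dummy gates inserted only to make the circuit layered. -/
def isGate {n m : ℕ} : CNode n m → Bool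
  | gand _ _ => true
  | gor _ _  => true
  | gnot _   => true
  | _        => false

/-- Nodes occupying space in a layer (real gates and COPY gates);
these are counted in the width of a layer. -/
def isWide {n m : ℕ} : CNode n m → Bool
  | gand _ _ => true
  | gor _ _  => true
  | gnot _   => true
  | gcopy _  => true
  | _        => false

end CNode

/-- A (nondeterministic) Boolean circuit with `n` actual inputs and `m` guess
inputs: a DAG whose in-degree-0 nodes are labeled by actual inputs, guess
inputs or constants, whose gates are AND/OR/NOT gates (plus dummy COPY gates),
with a designated output node.  Each guess input labels at most one node. -/
structure Circuit (n m : ℕ) : Type where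
  N : ℕ
  node : Fin N → CNode n m
  output : Fin N
  wf : ∀ i : Fin N, ∀ j ∈ (node i).preds, j < (i : ℕ)
  guessOnce : ∀ g : Fin m,
    (Finset.univ.filter (fun i : Fin N => node i = CNode.guess g)).card ≤ 1

namespace Circuit

variable {n m : ℕ}

def nodeAt (c : Circuit n m) (i : ℕ) : CNode n m :=
  if h : i < c.N then c.node ⟨i, h⟩ else CNode.const false

/-- The Boolean value computed at node `i` on actual inputs `x` and
guess inputs `y`. -/
def evalAux (c : Circuit n m) (x : Fin n → Bool) (y : Fin m → Bool) : ℕ → Bool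
  | i =>
    match c.nodeAt i with
    | CNode.actual a => x a
    | CNode.guess g => y g
    | CNode.const b => b
    | CNode.gand j k =>
        (if _h : j < i then c.evalAux x y j else false) &&
        (if _h : k < i then c.evalAux x y k else false)
    | CNode.gor j k =>
        (if _h : j < i then c.evalAux x y j else false) ||
        (if _h : k < i then c.evalAux x y k else false)
    | CNode.gnot j => !(if _h : j < i then c.evalAux x y j else false)
    | CNode.gcopy j => (if _h : j < i then c.evalAux x y j else false)
termination_by i => i

/-- The output value of the circuit. -/
def eval (c : Circuit n m) (x : Fin n → Bool) (y : Fin m → Bool) : Bool :=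
  c.evalAux x y c.output

/-- A nondeterministic circuit computes `f` if for every actual input `x`,
`f x = 1` iff some assignment of the guess inputs makes the circuit output 1.
(For `m = 0` this is the usual notion for deterministic circuits.) -/
def Computes (c : Circuit n m) (f : (Fin n → Bool) → Bool) : Prop :=
  ∀ x : Fin n → Bool, f x = true ↔ ∃ y : Fin m → Bool, c.eval x y = true

/-- The size of a circuit: the number of (non-COPY) gates. -/
def size (c : Circuit n m) : ℕ :=
  (Finset.univ.filter (fun i : Fin c.N => (c.node i).isGate = true)).card

/-- `ℓ` is a layering of the circuit: every wire goes between adjacent layers. -/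
def IsLayering (c : Circuit n m) (ℓ : Fin c.N → ℕ) : Prop :=
  ∀ i : Fin c.N, ∀ j ∈ (c.node i).preds, ∀ hj : j < c.N, ℓ ⟨j, hj⟩ + 1 = ℓ i

/-- The circuit has width at most `w`: there is a layering in which every layer
contains at most `w` gates (real gates and COPY gates). -/
def HasWidth (c : Circuit n m) (w : ℕ) : Prop :=
  ∃ ℓ : Fin c.N → ℕ, c.IsLayering ℓ ∧
    ∀ t : ℕ,
      (Finset.univ.filter
        (fun i : Fin c.N => ℓ i = t ∧ (c.node i).isWide = true)).card ≤ w

/-- The circuit is read-`k`-times: every actual input labels at most `k` nodes. -/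
def ReadK (c : Circuit n m) (k : ℕ) : Prop :=
  ∀ a : Fin n,
    (Finset.univ.filter (fun i : Fin c.N => c.node i = CNode.actual a)).card ≤ k

/-- The maximal number of (non-COPY) gates on a path ending at node `i`. -/
def depthAux (c : Circuit n m) : ℕ → ℕ
  | i =>
    match c.nodeAt i with
    | CNode.actual _ => 0
    | CNode.guess _ => 0
    | CNode.const _ => 0
    | CNode.gand j k =>
        max (if _h : j < i then c.depthAux j else 0)
            (if _h : k < i then c.depthAux k else 0) + 1
    | CNode.gor j k =>
        max (if _h : j < i then c.depthAux j else 0)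
            (if _h : k < i then c.depthAux k else 0) + 1
    | CNode.gnot j => (if _h : j < i then c.depthAux j else 0) + 1
    | CNode.gcopy j => (if _h : j < i then c.depthAux j else 0)
termination_by i => i

/-- The depth of a circuit: the maximal number of gates on a directed path
from an input to the output. -/
def depth (c : Circuit n m) : ℕ := c.depthAux c.output

end Circuit

/-- A nondeterministic branching program on `n` Boolean variables: a DAG whose
inner nodes are labeled by variables with outgoing edges labeled 0 or 1 (edges
go to strictly larger indices), whose sinks are labeled 0 or 1, with a
designated start node. -/
structure NBP (n : ℕ) : Type where
  N : ℕ
  label : Fin N → Fin n ⊕ Bool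
  edges : Fin N → Bool → Finset (Fin N)
  start : Fin N
  wf : ∀ i : Fin N, ∀ b : Bool, ∀ j ∈ edges i b,
        (i : ℕ) < (j : ℕ) ∧ (label i).isLeft

namespace NBP

variable {n : ℕ}

/-- The size of a branching program: the number of its nodes. -/
def size (B : NBP n) : ℕ := B.N

/-- On input `x`, some path from node `i` consistent with `x` reaches a 1-sink. -/
def AccFrom (B : NBP n) (x : Fin n → Bool) : Fin B.N → Prop
  | i =>
    match B.label i with
    | Sum.inr b => b = true
    | Sum.inl v => ∃ j ∈ B.edges i (x v), ∃ _h : (i : ℕ) < (j : ℕ), B.AccFrom x j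
termination_by i => B.N - (i : ℕ)
decreasing_by
  have := j.isLt
  omega

/-- A nondeterministic branching program computes `f` if for every `x`,
`f x = 1` iff at least one path consistent with `x` leads to a 1-sink. -/
def Computes (B : NBP n) (f : (Fin n → Bool) → Bool) : Prop :=
  ∀ x : Fin n → Bool, f x = true ↔ B.AccFrom x B.start

/-- A (syntactic) path in the underlying graph of the branching program. -/
def IsPath (B : NBP n) : List (Fin B.N) → Prop
  | [] => True
  | [_] => True
  | i :: j :: p => (∃ b : Bool, j ∈ B.edges i b) ∧ B.IsPath (j :: p)

/-- The branching program is syntactic read-`k`-times: every variable appears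
at most `k` times on each path. -/
def SyntacticReadK (B : NBP n) (k : ℕ) : Prop :=
  ∀ p : List (Fin B.N), B.IsPath p → ∀ v : Fin n,
    (p.countP fun i => decide (B.label i = Sum.inl v)) ≤ k

end NBP

/-- A node of a `U₂`-circuit.  A gate `gate a b c j k` computes
`((vⱼ ⊕ a) ∧ (v_k ⊕ b)) ⊕ c` from the values `vⱼ, v_k` of its two
predecessors; these are exactly the Boolean functions in `U₂`
(all two-variable Boolean functions except XOR and its complement). -/
inductive U2Node (n m : ℕ) : Type where
  | actual : Fin n → U2Node n m
  | guess  : Fin m → U2Node n m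
  | const  : Bool → U2Node n m
  | gate   : Bool → Bool → Bool → ℕ → ℕ → U2Node n m
deriving DecidableEq

namespace U2Node

def isGate {n m : ℕ} : U2Node n m → Bool
  | gate _ _ _ _ _ => true
  | _ => false

end U2Node

/-- A (nondeterministic) `U₂`-circuit with `n` actual inputs and `m` guess
inputs: every gate has fan-in 2 and is labeled by a function in `U₂`. -/
structure U2Circuit (n m : ℕ) : Type where
  N : ℕ
  node : Fin N → U2Node n m
  output : Fin N
  wf : ∀ i : Fin N, ∀ a b c j k,
        node i = U2Node.gate a b c j k → j < (i : ℕ) ∧ k < (i : ℕ)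

namespace U2Circuit

variable {n m : ℕ}

def nodeAt (c : U2Circuit n m) (i : ℕ) : U2Node n m :=
  if h : i < c.N then c.node ⟨i, h⟩ else U2Node.const false

def evalAux (c : U2Circuit n m) (x : Fin n → Bool) (y : Fin m → Bool) : ℕ → Bool
  | i =>
    match c.nodeAt i with
    | U2Node.actual a => x a
    | U2Node.guess g => y g
    | U2Node.const b => b
    | U2Node.gate a b cc j k =>
        xor
          ((xor (if _h : j < i then c.evalAux x y j else false) a) &&
           (xor (if _h : k < i then c.evalAux x y k else false) b))
          cc
termination_by i => i

def eval (c : U2Circuit n m) (x : Fin n → Bool) (y : Fin m → Bool) : Bool :=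
  c.evalAux x y c.output

/-- A nondeterministic `U₂`-circuit computes `f` if for every actual input `x`,
`f x = 1` iff some assignment of the guess inputs makes the circuit output 1. -/
def Computes (c : U2Circuit n m) (f : (Fin n → Bool) → Bool) : Prop :=
  ∀ x : Fin n → Bool, f x = true ↔ ∃ y : Fin m → Bool, c.eval x y = true

/-- The size of a `U₂`-circuit: the number of its gates. -/
def size (c : U2Circuit n m) : ℕ :=
  (Finset.univ.filter (fun i : Fin c.N => (c.node i).isGate = true)).card

end U2Circuit

/-- `size^dc f`: the size of the smallest deterministic `U₂`-circuit
computing `f`. -/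
noncomputable def sizeDC {n : ℕ} (f : (Fin n → Bool) → Bool) : ℕ :=
  sInf {s : ℕ | ∃ c : U2Circuit n 0, c.Computes f ∧ c.size = s}

/-- `size^ndc f`: the size of the smallest nondeterministic `U₂`-circuit
computing `f`. -/
noncomputable def sizeNDC {n : ℕ} (f : (Fin n → Bool) → Bool) : ℕ :=
  sInf {s : ℕ | ∃ m : ℕ, ∃ c : U2Circuit n m, c.Computes f ∧ c.size = s}

/-- The parity function: `parityFun n x = 1` iff `Σ xᵢ ≡ 1 (mod 2)`. -/
def parityFun (n : ℕ) : (Fin n → Bool) → Bool :=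
  fun x => decide ((∑ i : Fin n, (x i).toNat) % 2 = 1)

theorem blockIdx_lt {m : ℕ} (i j : Fin m) : m * (i : ℕ) + (j : ℕ) < m * m := by
  have hi := i.isLt
  have hj := j.isLt
  nlinarith

/-- The disjunction of the parities of the `m` consecutive blocks of `m`
variables:
`⋁_{i=0}^{m-1} Parity_m (x_{m·i+1}, …, x_{m·i+m})` on `n = m²` variables. -/
def blockParityOr (m : ℕ) : (Fin (m * m) → Bool) → Bool :=
  fun x => decide (∃ i : Fin m,
    parityFun m (fun j => x ⟨m * (i : ℕ) + (j : ℕ), blockIdx_lt i j⟩) = true)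

section LowerBound

variable {ι : Type*}

/-- `g` is, up to negation, a constant, a variable from `V`, or one of the functions `f s` with
`s ∈ S` and `s < t`. -/
def IsSource (V : Finset ι) (S : Finset ℕ) (f : ℕ → (ι → Bool) → Bool) (t : ℕ)
    (g : (ι → Bool) → Bool) : Prop :=
  (∃ b, g = fun _ => b) ∨ (∃ i ∈ V, ∃ b, g = fun x => xor (x i) b) ∨
    (∃ s ∈ S, s < t ∧ ∃ b, g = fun x => xor (f s x) b)

/-- Every `f t` with `t ∈ S` is obtained by a `U₂`-gate from sources preceding `t`. -/
def IsGateChain (V : Finset ι) (S : Finset ℕ) (f : ℕ → (ι → Bool) → Bool) : Prop :=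
  ∀ t ∈ S, ∃ p q c, IsSource V S f t p ∧ IsSource V S f t q ∧
    f t = fun x => xor (p x && q x) c

/-- Flipping any variable of `V` flips the value of `g`. -/
def Toggles [DecidableEq ι] (V : Finset ι) (g : (ι → Bool) → Bool) : Prop :=
  ∀ x, ∀ i ∈ V, g (Function.update x i (!x i)) = !g x

variable {V : Finset ι} {S : Finset ℕ} {f : ℕ → (ι → Bool) → Bool} {t u : ℕ}
  {g p q : (ι → Bool) → Bool}

theorem IsSource.xor_const (h : IsSource V S f t g) (c : Bool) :
    IsSource V S f t (fun x => xor (g x) c) := by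
  rcases h with ⟨b, rfl⟩ | ⟨i, hi, b, rfl⟩ | ⟨s, hs, hst, b, rfl⟩
  · exact Or.inl ⟨xor b c, rfl⟩
  · exact Or.inr (Or.inl ⟨i, hi, xor b c, by simp⟩)
  · exact Or.inr (Or.inr ⟨s, hs, hst, xor b c, by simp⟩)

theorem IsSource.mono (h : IsSource V S f t g) (htu : t ≤ u) : IsSource V S f u g := by
  rcases h with h | h | ⟨s, hs, hst, h⟩
  · exact Or.inl h
  · exact Or.inr (Or.inl h)
  · exact Or.inr (Or.inr ⟨s, hs, hst.trans_le htu, h⟩)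

theorem IsSource.and_const (h : IsSource V S f t g) (b c : Bool) :
    IsSource V S f t (fun x => xor (b && g x) c) := by
  cases b
  · exact Or.inl ⟨c, by simp⟩
  · simpa using h.xor_const c

theorem IsSource.erase_of_isSource (h : IsSource V S f u g) (ht : IsSource V S f t (f t)) :
    IsSource V (S.erase t) f u g := by
  rcases h with h | h | ⟨s, hs, hsu, b, rfl⟩
  · exact Or.inl h
  · exact Or.inr (Or.inl h)
  by_cases hst : s = t
  · subst hst
    refine IsSource.xor_const (IsSource.mono ?_ hsu.le) b
    rcases ht with h | h | ⟨r, hr, hrs, h⟩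
    · exact Or.inl h
    · exact Or.inr (Or.inl h)
    · exact Or.inr (Or.inr ⟨r, Finset.mem_erase.2 ⟨hrs.ne, hr⟩, hrs, h⟩)
  · exact Or.inr (Or.inr ⟨s, Finset.mem_erase.2 ⟨hst, hs⟩, hsu, b, rfl⟩)

theorem IsSource.erase_of_ne (h : IsSource V S f u g)
    (hne : ∀ b, g ≠ fun x => xor (f t x) b) : IsSource V (S.erase t) f u g := by
  rcases h with h | h | ⟨s, hs, hsu, b, rfl⟩
  · exact Or.inl h
  · exact Or.inr (Or.inl h)
  · refine Or.inr (Or.inr ⟨s, Finset.mem_erase.2 ⟨?_, hs⟩, hsu, b, rfl⟩)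
    rintro rfl
    exact hne b rfl

theorem IsGateChain.erase_of_isSource (h : IsGateChain V S f) (ht : IsSource V S f t (f t)) :
    IsGateChain V (S.erase t) f := by
  intro s hs
  obtain ⟨p, q, c, hp, hq, e⟩ := h s (Finset.mem_of_mem_erase hs)
  exact ⟨p, q, c, hp.erase_of_isSource ht, hq.erase_of_isSource ht, e⟩

variable [DecidableEq ι]

theorem IsSource.restrict (h : IsSource V S f t g) (i : ι) (a : Bool) :
    IsSource (V.erase i) S (fun s x => f s (Function.update x i a)) t
      (fun x => g (Function.update x i a)) := by
  rcases h with ⟨b, rfl⟩ | ⟨j, hj, b, rfl⟩ | ⟨s, hs, hst, b, rfl⟩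
  · exact Or.inl ⟨b, rfl⟩
  · by_cases hji : j = i
    · subst hji
      exact Or.inl ⟨xor a b, by simp⟩
    · exact Or.inr (Or.inl ⟨j, Finset.mem_erase.2 ⟨hji, hj⟩, b, by simp [hji]⟩)
  · exact Or.inr (Or.inr ⟨s, hs, hst, b, rfl⟩)

theorem IsGateChain.restrict (h : IsGateChain V S f) (i : ι) (a : Bool) :
    IsGateChain (V.erase i) S (fun s x => f s (Function.update x i a)) := by
  intro t ht
  obtain ⟨p, q, c, hp, hq, e⟩ := h t ht
  exact ⟨_, _, c, hp.restrict i a, hq.restrict i a, by simp [e]⟩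

theorem Toggles.restrict (h : Toggles V g) (i : ι) (a : Bool) :
    Toggles (V.erase i) (fun x => g (Function.update x i a)) := by
  intro x j hj
  obtain ⟨hji, hj⟩ := Finset.mem_erase.1 hj
  have := h (Function.update x i a) j hj
  rw [Function.update_of_ne hji] at this
  simp only [Function.update_comm hji, this]

/-- A toggling function still varies with a second variable after one is fixed. -/
theorem Toggles.exists_ne {i j : ι} (h : Toggles V g) (hj : j ∈ V) (hij : j ≠ i)
    (a : Bool) (x : ι → Bool) : g (Function.update (Function.update x j (!x j)) i a) ≠
      g (Function.update x i a) := by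
  have := h.restrict i a x j (Finset.mem_erase.2 ⟨hij, hj⟩)
  simp only at this
  simp [this]

theorem Toggles.ne_literal {i j : ι} (h : Toggles V g) (hj : j ∈ V) (hij : j ≠ i) (b : Bool) :
    g ≠ fun x => xor (x i) b := by
  rintro rfl
  exact h.exists_ne hj hij false (fun _ => false) (by simp)

/-- In a chain none of whose members is a source at its own position, some variable feeds
two distinct gates, provided that a toggling function of at least two variables is computed. -/
theorem exists_literal_feeding_two {o : ℕ} {P Q : ℕ → (ι → Bool) → Bool} {C : ℕ → Bool}
    (hP : ∀ t ∈ S, IsSource V S f t (P t)) (hQ : ∀ t ∈ S, IsSource V S f t (Q t))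
    (hf : ∀ t ∈ S, f t = fun x => xor (P t x && Q t x) (C t))
    (hred : ∀ t ∈ S, ¬ IsSource V S f t (f t))
    (hg : IsSource V S f o g) (hT : Toggles V g) (hV : 2 ≤ V.card) :
    ∃ i ∈ V, ∃ A ∈ S, ∃ B ∈ S, A < B ∧
      (∃ b, P A = (fun x => xor (x i) b) ∨ Q A = fun x => xor (x i) b) ∧
      (∃ b, P B = (fun x => xor (x i) b) ∨ Q B = fun x => xor (x i) b) := by
  have not_lit : ∀ i b, g ≠ fun x => xor (x i) b := by
    intro i b
    obtain ⟨j, hj, hji⟩ := Finset.exists_mem_ne hV i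
    exact hT.ne_literal hj hji b
  have hS : S.Nonempty := by
    have hVpos : 0 < V.card := by omega
    obtain ⟨i, hi⟩ := Finset.card_pos.1 hVpos
    rcases hg with ⟨b, rfl⟩ | ⟨i, hi, b, h⟩ | ⟨s, hs, -⟩
    · simpa using hT (fun _ => false) i hi
    · exact absurd h (not_lit i b)
    · exact ⟨s, hs⟩
  set m := S.min' hS with hm
  have hmS : m ∈ S := S.min'_mem hS
  have hmin : ∀ s ∈ S, ¬ s < m := fun s hs => not_lt.2 (S.min'_le s hs)
  have hPm := hP m hmS
  have hQm := hQ m hmS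
  have hfm := hf m hmS
  have hrm := hred m hmS
  obtain ⟨i, hi, a, ha⟩ : ∃ i ∈ V, ∃ a, P m = fun x => xor (x i) a := by
    rcases hPm with ⟨b, h⟩ | h | ⟨s, hs, hsm, -⟩
    · refine absurd ?_ hrm
      rw [hfm, h]
      exact hQm.and_const b _
    · exact h
    · exact absurd hsm (hmin s hs)
  obtain ⟨j, hj, b, hb⟩ : ∃ i ∈ V, ∃ a, Q m = fun x => xor (x i) a := by
    rcases hQm with ⟨b, h⟩ | h | ⟨s, hs, hsm, -⟩
    · refine absurd ?_ hrm
      rw [hfm, h]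
      simpa only [Bool.and_comm] using hPm.and_const b (C m)
    · exact h
    · exact absurd hsm (hmin s hs)
  have hij : i ≠ j := by
    rintro rfl
    apply hrm
    rw [hfm, ha, hb]
    by_cases hab : a = b
    · subst hab
      exact Or.inr (Or.inl ⟨i, hi, xor a (C m), by simp⟩)
    · refine Or.inl ⟨C m, funext fun x => ?_⟩
      revert hab
      cases a <;> cases b <;> cases x i <;> simp
  obtain ⟨u, hu, hum, huf⟩ : ∃ u ∈ S, u ≠ m ∧
      ∃ b, P u = (fun x => xor (x i) b) ∨ Q u = fun x => xor (x i) b := by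
    by_contra! hcon
    have indep : ∀ s ∈ S, ∀ x, f s (Function.update (Function.update x i (!x i)) j b) =
        f s (Function.update x j b) := by
      intro s
      induction s using Nat.strong_induction_on with
      | _ s ih =>
        intro hs x
        have aux : ∀ h, IsSource V S f s h → (∀ b, h ≠ fun x => xor (x i) b) →
            h (Function.update (Function.update x i (!x i)) j b) =
              h (Function.update x j b) := by
          rintro h (⟨c, rfl⟩ | ⟨k, hk, c, rfl⟩ | ⟨r, hr, hrs, c, rfl⟩) hne
          · rfl
          · have hki : k ≠ i := by
              rintro rfl
              exact hne c rfl
            simp [Function.update_apply, hki]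
          · simp only [ih r hrs hr x]
        by_cases hsm : s = m
        · rw [hsm, hfm, hb]
          simp
        · rw [hf s hs]
          simp only [aux _ (hP s hs) fun c => (hcon s hs hsm c).1,
            aux _ (hQ s hs) fun c => (hcon s hs hsm c).2]
    rcases hg with ⟨c, rfl⟩ | ⟨k, hk, c, h⟩ | ⟨s, hs, -, c, rfl⟩
    · exact hT.exists_ne hi hij false (fun _ => false) rfl
    · exact not_lit k c h
    · refine hT.exists_ne hi hij b (fun _ => false) ?_
      simp only [indep s hs]
  exact ⟨i, hi, m, hmS, u, hu, lt_of_le_of_ne (S.min'_le u hu) hum.symm, ⟨a, Or.inl ha⟩, huf⟩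

theorem IsSource.of_feed {i : ι} {c b : Bool} (hp : IsSource V S f t p)
    (hq : IsSource V S f t q) (hf : f t = fun x => xor (p x && q x) c)
    (h : p = (fun x => xor (x i) b) ∨ q = fun x => xor (x i) b) (a : Bool) :
    IsSource (V.erase i) S (fun s x => f s (Function.update x i a)) t
      (fun x => f t (Function.update x i a)) := by
  rcases h with rfl | rfl
  · simpa [hf] using (hq.restrict i a).and_const (xor a b) c
  · simpa [hf, Bool.and_comm] using (hp.restrict i a).and_const (xor a b) c

/-- **Schnorr's gate elimination bound.** -/
theorem IsGateChain.three_mul_card_sub_one_le (o : ℕ) (V : Finset ι) (S : Finset ℕ)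
    (f : ℕ → (ι → Bool) → Bool) (g : (ι → Bool) → Bool) (hch : IsGateChain V S f)
    (hg : IsSource V S f o g) (hT : Toggles V g) : 3 * (V.card - 1) ≤ S.card := by
  induction hk : S.card using Nat.strong_induction_on generalizing V S f g with
  | _ k ih =>
  subst hk
  by_cases hV : V.card < 2
  · omega
  rw [not_lt] at hV
  by_cases hred : ∃ t ∈ S, IsSource V S f t (f t)
  · obtain ⟨t, htS, ht⟩ := hred
    have hlt := Finset.card_erase_lt_of_mem htS
    exact (ih _ hlt V _ f g (hch.erase_of_isSource ht) (hg.erase_of_isSource ht) hT rfl).trans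
      hlt.le
  push Not at hred
  choose! P Q C hP hQ hf using hch
  obtain ⟨i, hi, A, hA, B, hB, hAB, ⟨a, ha⟩, b, hb⟩ :=
    exists_literal_feeding_two hP hQ hf hred hg hT hV
  have hconst : ∀ x, f B (Function.update x i b) = C B := by
    intro x
    rcases hb with h | h <;> simp [hf B hB, h]
  have hgB : ∀ c, g ≠ fun x => xor (f B x) c := by
    rintro c rfl
    obtain ⟨j, hj, hji⟩ := Finset.exists_mem_ne hV i
    refine hT.exists_ne hj hji b (fun _ => false) ?_
    simp only [hconst]
  by_cases hfeed : ∃ H ∈ S, ∃ c, P H = (fun x => xor (f B x) c) ∨ Q H = fun x => xor (f B x) c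
  swap
  · push Not at hfeed
    have hlt := Finset.card_erase_lt_of_mem hB
    refine (ih _ hlt V _ f g ?_ (hg.erase_of_ne hgB) hT rfl).trans hlt.le
    intro s hs
    have hs' := Finset.mem_of_mem_erase hs
    exact ⟨P s, Q s, C s, (hP s hs').erase_of_ne fun c => (hfeed s hs' c).1,
      (hQ s hs').erase_of_ne fun c => (hfeed s hs' c).2, hf s hs'⟩
  obtain ⟨H, hH, c, hHf⟩ := hfeed
  have hBH : B < H := by
    by_contra hle
    rw [not_lt] at hle
    apply hred B hB
    rcases hHf with h | h
    · have := ((hP H hH).xor_const c).mono hle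
      simpa [h] using this
    · have := ((hQ H hH).xor_const c).mono hle
      simpa [h] using this
  have hch : IsGateChain V S f := fun t ht => ⟨P t, Q t, C t, hP t ht, hQ t ht, hf t ht⟩
  set f' : ℕ → (ι → Bool) → Bool := fun s x => f s (Function.update x i b) with hf'
  have sA : IsSource (V.erase i) S f' A (f' A) :=
    IsSource.of_feed (hP A hA) (hQ A hA) (hf A hA) ha b
  have sB : IsSource (V.erase i) S f' B (f' B) := Or.inl ⟨C B, funext hconst⟩
  have sH : IsSource (V.erase i) S f' H (f' H) := by
    rcases hHf with h | h
    · simpa [hf', hf H hH, h, hconst] using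
        ((hQ H hH).restrict i b).and_const (xor (C B) c) (C H)
    · simpa [hf', hf H hH, h, hconst, Bool.and_comm] using
        ((hP H hH).restrict i b).and_const (xor (C B) c) (C H)
  have sB' := sB.erase_of_isSource sH
  have sA' := (sA.erase_of_isSource sH).erase_of_isSource sB'
  have hcard : (((S.erase H).erase B).erase A).card + 3 = S.card := by
    have hB' : B ∈ S.erase H := Finset.mem_erase.2 ⟨hBH.ne, hB⟩
    have hA' : A ∈ (S.erase H).erase B :=
      Finset.mem_erase.2 ⟨hAB.ne, Finset.mem_erase.2 ⟨(hAB.trans hBH).ne, hA⟩⟩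
    rw [← Finset.card_erase_add_one hH, ← Finset.card_erase_add_one hB',
      ← Finset.card_erase_add_one hA']
  have key := ih _ (by omega) (V.erase i) _ f' _
    ((((hch.restrict i b).erase_of_isSource sH).erase_of_isSource sB').erase_of_isSource sA')
    ((((hg.restrict i b).erase_of_isSource sH).erase_of_isSource sB').erase_of_isSource sA')
    (hT.restrict i b) rfl
  rw [Finset.card_erase_of_mem hi] at key
  omega

end LowerBound

theorem parityFun_toggles (n : ℕ) : Toggles Finset.univ (parityFun n) := by
  intro x i _
  have h1 := Finset.add_sum_erase Finset.univ (fun j => (x j).toNat) (Finset.mem_univ i)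
  have h2 := Finset.add_sum_erase Finset.univ
    (fun j => (Function.update x i (!x i) j).toNat) (Finset.mem_univ i)
  have h3 : ∑ j ∈ Finset.univ.erase i, (Function.update x i (!x i) j).toNat =
      ∑ j ∈ Finset.univ.erase i, (x j).toNat :=
    Finset.sum_congr rfl fun j hj => by rw [Function.update_of_ne (Finset.ne_of_mem_erase hj)]
  rw [h3] at h2
  simp only [Function.update_self] at h2
  simp only [parityFun, ← h1, ← h2]
  generalize ∑ j ∈ Finset.univ.erase i, (x j).toNat = s
  cases x i <;> simp <;> grind

namespace U2Circuit

variable {n m : ℕ} (c : U2Circuit n m) (x : Fin n → Bool) (y : Fin m → Bool) {i : ℕ}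

theorem evalAux_actual {v : Fin n} (h : c.nodeAt i = U2Node.actual v) :
    c.evalAux x y i = x v := by
  rw [evalAux, h]

theorem evalAux_const {b : Bool} (h : c.nodeAt i = U2Node.const b) :
    c.evalAux x y i = b := by
  rw [evalAux, h]

theorem evalAux_gate {a b d : Bool} {j k : ℕ} (h : c.nodeAt i = U2Node.gate a b d j k)
    (hj : j < i) (hk : k < i) : c.evalAux x y i =
      xor ((xor (c.evalAux x y j) a) && (xor (c.evalAux x y k) b)) d := by
  rw [evalAux, h]
  simp [hj, hk]

theorem size_eq_card_range : c.size =
    ((Finset.range c.N).filter fun i => (c.nodeAt i).isGate = true).card := by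
  rw [size, ← Finset.card_map Fin.valEmbedding]
  congr 1
  ext i
  simp only [Finset.mem_map, Finset.mem_filter, Finset.mem_univ, true_and, Finset.mem_range,
    Fin.valEmbedding_apply]
  constructor
  · rintro ⟨j, hj, rfl⟩
    exact ⟨j.isLt, by simpa [nodeAt] using hj⟩
  · rintro ⟨hi, h⟩
    exact ⟨⟨i, hi⟩, by simpa [nodeAt, hi] using h, rfl⟩

theorem three_mul_sub_one_le_size {n : ℕ} (c : U2Circuit n 0) (hc : c.Computes (parityFun n)) :
    3 * (n - 1) ≤ c.size := by
  let S := (Finset.range c.N).filter fun i => (c.nodeAt i).isGate = true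
  let y : Fin 0 → Bool := Fin.elim0
  let f : ℕ → (Fin n → Bool) → Bool := fun t x => c.evalAux x y t
  have hsrc : ∀ j < c.N, ∀ t, j < t → ∀ b,
      IsSource Finset.univ S f t (fun x => xor (f j x) b) := by
    intro j hj t hjt b
    refine IsSource.xor_const ?_ b
    cases h : c.nodeAt j with
    | actual v =>
      exact Or.inr (Or.inl ⟨v, Finset.mem_univ v, false, funext fun x => by
        simp [f, c.evalAux_actual x y h]⟩)
    | guess v => exact v.elim0
    | const b => exact Or.inl ⟨b, funext fun x => c.evalAux_const x y h⟩
    | gate =>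
      have hjS : j ∈ S :=
        Finset.mem_filter.2 ⟨Finset.mem_range.2 hj, by rw [h]; rfl⟩
      exact Or.inr (Or.inr ⟨j, hjS, hjt, false, by simp⟩)
  have hchain : IsGateChain Finset.univ S f := by
    intro t ht
    obtain ⟨htN, hg⟩ := Finset.mem_filter.1 ht
    rw [Finset.mem_range] at htN
    cases h : c.nodeAt t with
    | gate a b d j k =>
      obtain ⟨hj, hk⟩ := c.wf ⟨t, htN⟩ a b d j k (by simpa [nodeAt, htN] using h)
      exact ⟨_, _, d, hsrc j (hj.trans htN) t hj a, hsrc k (hk.trans htN) t hk b,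
        funext fun x => c.evalAux_gate x y h hj hk⟩
    | _ => simp [h, U2Node.isGate] at hg
  have hout : IsSource Finset.univ S f c.N (parityFun n) := by
    have : parityFun n = fun x => xor (f c.output x) false := by
      funext x
      rw [Bool.xor_false, Bool.eq_iff_iff, hc x]
      exact ⟨fun ⟨z, hz⟩ => by rwa [Subsingleton.elim z y] at hz, fun h => ⟨y, h⟩⟩
    rw [this]
    exact hsrc _ c.output.isLt _ c.output.isLt false
  rw [size_eq_card_range]
  simpa using hchain.three_mul_card_sub_one_le c.N _ _ _ _ hout (parityFun_toggles n)

/-- The node holding the parity of the first `k + 1` inputs in `parityCircuit n`. -/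
def parityAcc (n k : ℕ) : ℕ := if k = 0 then 0 else n + 3 * k - 1

/-- Inputs come first; then, for every further input, three gates form its exclusive or with
the parity of the preceding ones. -/
def parityNode (n i : ℕ) : U2Node n 0 :=
  if h : i < n then U2Node.actual ⟨i, h⟩
  else if (i - n) % 3 = 0 then
    U2Node.gate false true false (parityAcc n ((i - n) / 3)) ((i - n) / 3 + 1)
  else if (i - n) % 3 = 1 then
    U2Node.gate true false false (parityAcc n ((i - n) / 3)) ((i - n) / 3 + 1)
  else U2Node.gate true true true (i - 2) (i - 1)

/-- A `U₂`-circuit with `3 * (n - 1)` gates computing parity. -/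
def parityCircuit (n : ℕ) (hn : 2 ≤ n) : U2Circuit n 0 where
  N := n + 3 * (n - 1)
  node i := parityNode n i
  output := ⟨n + 3 * (n - 1) - 1, by omega⟩
  wf := by
    rintro ⟨i, hi⟩ a b c j k h
    simp only [parityNode, parityAcc] at h
    split_ifs at h <;> simp only [U2Node.gate.injEq] at h <;> grind

theorem parityCircuit_nodeAt (hn : 2 ≤ n) (hi : i < n + 3 * (n - 1)) :
    (parityCircuit n hn).nodeAt i = parityNode n i := by
  simp [nodeAt, parityCircuit, hi]

theorem parityCircuit_evalAux_input (hn : 2 ≤ n) (y : Fin 0 → Bool) (v : Fin n) :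
    (parityCircuit n hn).evalAux x y v = x v := by
  apply evalAux_actual
  rw [parityCircuit_nodeAt hn (by omega)]
  simp [parityNode]

theorem parityCircuit_evalAux_acc (hn : 2 ≤ n) (y : Fin 0 → Bool) (k : ℕ) (hk : k < n) :
    (parityCircuit n hn).evalAux x y (parityAcc n k) =
      decide ((∑ i ∈ Finset.range (k + 1), if h : i < n then (x ⟨i, h⟩).toNat else 0) % 2 = 1) := by
  induction k with
  | zero =>
    have h0 : 0 < n := by omega
    have := parityCircuit_evalAux_input x hn y ⟨0, h0⟩
    simp only [parityAcc, if_true] at this ⊢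
    rw [this]
    simp only [zero_add, Finset.sum_range_one, h0, dif_pos]
    cases x ⟨0, h0⟩ <;> simp
  | succ k ih =>
    specialize ih (by omega)
    have hacc : parityAcc n (k + 1) = n + 3 * k + 2 := by simp [parityAcc]; omega
    have hlt : parityAcc n k < n + 3 * k := by
      simp only [parityAcc]
      split_ifs <;> omega
    have hv := parityCircuit_evalAux_input x hn y ⟨k + 1, hk⟩
    simp only at hv
    have n0 : (parityCircuit n hn).nodeAt (n + 3 * k) =
        U2Node.gate false true false (parityAcc n k) (k + 1) := by
      rw [parityCircuit_nodeAt hn (by omega)]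
      simp [parityNode]
    have n1 : (parityCircuit n hn).nodeAt (n + 3 * k + 1) =
        U2Node.gate true false false (parityAcc n k) (k + 1) := by
      rw [parityCircuit_nodeAt hn (by omega)]
      have e1 : n + 3 * k + 1 - n = 3 * k + 1 := by omega
      have e2 : (3 * k + 1) / 3 = k := by omega
      have e3 : (3 * k + 1) % 3 = 1 := by omega
      have e4 : ¬ n + 3 * k + 1 < n := by omega
      simp [parityNode, e1, e2, e3, e4]
    have n2 : (parityCircuit n hn).nodeAt (n + 3 * k + 2) =
        U2Node.gate true true true (n + 3 * k) (n + 3 * k + 1) := by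
      rw [parityCircuit_nodeAt hn (by omega)]
      have e1 : n + 3 * k + 2 - n = 3 * k + 2 := by omega
      have e3 : (3 * k + 2) % 3 = 2 := by omega
      have e4 : ¬ n + 3 * k + 2 < n := by omega
      simp [parityNode, e1, e3, e4]
    rw [hacc, evalAux_gate _ x y n2 (by omega) (by omega),
      evalAux_gate _ x y n0 (by omega) (by omega),
      evalAux_gate _ x y n1 (by omega) (by omega), ih, hv, Finset.sum_range_succ _ (k + 1)]
    simp only [hk, dif_pos]
    generalize (∑ i ∈ Finset.range (k + 1), if h : i < n then (x ⟨i, h⟩).toNat else 0) = s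
    rcases Nat.mod_two_eq_zero_or_one s with h | h <;> cases x ⟨k + 1, hk⟩ <;>
      simp [Nat.add_mod, h]

theorem parityCircuit_computes (hn : 2 ≤ n) :
    (parityCircuit n hn).Computes (parityFun n) := by
  intro x
  have key : ∀ y, (parityCircuit n hn).eval x y = parityFun n x := by
    intro y
    have h := parityCircuit_evalAux_acc x hn y (n - 1) (by omega)
    have hacc : parityAcc n (n - 1) = n + 3 * (n - 1) - 1 := by
      rw [parityAcc, if_neg (by omega)]
    rw [hacc, Nat.sub_add_cancel (by omega), ← Fin.sum_univ_eq_sum_range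
      (fun i => if h : i < n then (x ⟨i, h⟩).toNat else 0)] at h
    simpa [eval, parityFun, parityCircuit] using h
  simp [key]

theorem parityCircuit_size_le (hn : 2 ≤ n) : (parityCircuit n hn).size ≤ 3 * (n - 1) := by
  rw [size_eq_card_range]
  calc _ ≤ (Finset.Ico n (n + 3 * (n - 1))).card := by
        refine Finset.card_le_card fun i hi => ?_
        obtain ⟨hi, hg⟩ := Finset.mem_filter.1 hi
        have hi : i < n + 3 * (n - 1) := Finset.mem_range.1 hi
        rw [parityCircuit_nodeAt hn hi] at hg
        refine Finset.mem_Ico.2 ⟨?_, hi⟩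
        by_contra hlt
        simp [parityNode, not_le.1 hlt, U2Node.isGate] at hg
    _ = _ := by simp

end U2Circuit

/-- **Schnorr.**  For every `n ≥ 2`, the size of the smallest
deterministic `U₂`-circuit computing the parity function of `n` inputs is
exactly `3(n−1)`. -/
theorem sizeDC_parity (n : ℕ) (hn : 2 ≤ n) :
    sizeDC (parityFun n) = 3 * (n - 1) := by
  apply le_antisymm
  · have hsize := U2Circuit.parityCircuit_size_le hn
    exact le_trans (Nat.sInf_le ⟨U2Circuit.parityCircuit n hn, U2Circuit.parityCircuit_computes hn, rfl⟩)
      hsize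
  · refine le_csInf ⟨_, U2Circuit.parityCircuit n hn, U2Circuit.parityCircuit_computes hn, rfl⟩ ?_
    rintro _ ⟨c, hc, rfl⟩
    exact c.three_mul_sub_one_le_size hc
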